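/- arXiv:2003.12586 — 8 statements merged into one kernel-verified Lean document; each statement's English description precedes it below -/
import Mathlib

section
/- Let k be an algebraically closed field and let f ∈ k[T]_ℚ be a nonzero element. Then the set of values {φ(T) : φ is a k-algebra homomorphism k[T]_ℚ → k with φ(f) = 0} is finite; that is, f has only finitely many zeros. -/
open scoped NNRat

/-- Over an algebraically closed field `k`, a nonzero `f ∈ k[T]_ℚ` has only
finitely many zeros, where a zero of `f` is the value `φ(T)` of a `k`-algebra homomorphism
`φ : k[T]_ℚ → k` annihilating `f`. -/
theorem stmt1 (k : Type*) [Field k] [IsAlgClosed k]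
    (f : AddMonoidAlgebra k ℚ≥0) (hf : f ≠ 0) :
    {x : k | ∃ φ : AddMonoidAlgebra k ℚ≥0 →ₐ[k] k,
      φ f = 0 ∧ φ (AddMonoidAlgebra.single 1 1) = x}.Finite := by
  classical
  -- common denominator
  obtain ⟨N, hN, e, he⟩ : ∃ N : ℕ, N ≠ 0 ∧ ∃ e : ℚ≥0 → ℕ,
      ∀ q ∈ f.coeff.support, q = e q * (1 / (N : ℚ≥0)) := by
    have hN : (∏ q ∈ f.coeff.support, q.den) ≠ 0 :=
      Finset.prod_ne_zero_iff.2 fun q _ => q.den_ne_zero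
    refine ⟨_, hN, fun q => q.num * ((∏ q ∈ f.coeff.support, q.den) / q.den), fun q hq => ?_⟩
    obtain ⟨c, hc⟩ := Finset.dvd_prod_of_mem NNRat.den hq
    rw [hc] at hN ⊢
    have hd : q.den ≠ 0 := q.den_ne_zero
    have hc0 : c ≠ 0 := right_ne_zero_of_mul hN
    beta_reduce
    rw [Nat.mul_div_cancel_left _ (Nat.pos_of_ne_zero hd)]
    have h1 : (q.den : ℚ≥0) ≠ 0 := by exact_mod_cast hd
    have h2 : (c : ℚ≥0) ≠ 0 := by exact_mod_cast hc0
    have h3 := NNRat.num_div_den q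
    push_cast
    nth_rewrite 1 [← h3]
    field_simp
  set p : Polynomial k := ∑ q ∈ f.coeff.support, Polynomial.monomial (e q) (f.coeff q) with hp
  have hp0 : p ≠ 0 := by
    obtain ⟨q, hq⟩ : f.coeff.support.Nonempty := by
      rw [Finsupp.support_nonempty_iff]
      intro h
      apply hf
      ext x
      simp [h]
    intro h
    have h1 : p.coeff (e q) = f.coeff q := by
      rw [hp, Polynomial.finsetSum_coeff, Finset.sum_eq_single q]
      · simp
      · intro b hb hbq
        rw [Polynomial.coeff_monomial, if_neg]
        intro hbe
        apply hbq
        rw [he b hb, he q hq, hbe]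
      · intro h; exact absurd hq h
    rw [h] at h1
    exact (Finsupp.mem_support_iff.1 hq) (by simpa using h1.symm)
  refine ((p.roots.toFinset.finite_toSet).image (fun y => y ^ N)).subset ?_
  rintro x ⟨φ, hφ, rfl⟩
  refine ⟨φ (AddMonoidAlgebra.single (1 / (N : ℚ≥0)) 1), ?_, ?_⟩
  · simp only [Finset.mem_coe, Multiset.mem_toFinset, Polynomial.mem_roots hp0, Polynomial.IsRoot.def]
    rw [← hφ, hp, Polynomial.eval_finsetSum]
    conv_rhs => rw [← AddMonoidAlgebra.sum_coeff_single f]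
    rw [Finsupp.sum, map_sum]
    refine Finset.sum_congr rfl fun q hq => ?_
    rw [Polynomial.eval_monomial, ← map_pow, AddMonoidAlgebra.single_pow, one_pow, nsmul_eq_mul,
      ← he q hq, ← smul_eq_mul, ← map_smul]
    simp
  · have h2 : (N : ℚ≥0) ≠ 0 := by exact_mod_cast hN
    simp only
    rw [← map_pow, AddMonoidAlgebra.single_pow, one_pow, nsmul_eq_mul, mul_one_div_cancel h2]
end

section
/- Let k be a field and let 𝔮 be the ideal of k[T]_ℚ generated by the monomials T^q with q > 0 (equivalently, 𝔮 is the kernel of the augmentation k-algebra homomorphism k[T]_ℚ → k sending each f to its coefficient at exponent 0). Then 𝔮 is a maximal ideal of k[T]_ℚ and 𝔮² = 𝔮; in particular the Zariski cotangent space 𝔮/𝔮² is zero. -/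
open scoped NNRat

/-- The monoid hom `r ↦ 0^r`. -/
noncomputable def augMon (k : Type*) [Field k] : Multiplicative ℚ≥0 →* k where
  toFun r := if r.toAdd = 0 then 1 else 0
  map_one' := by simp
  map_mul' a b := by
    simp only [toAdd_mul, add_eq_zero]
    split_ifs <;> simp_all

/-- The augmentation. -/
noncomputable def aug (k : Type*) [Field k] : AddMonoidAlgebra k ℚ≥0 →ₐ[k] k :=
  AddMonoidAlgebra.lift k k ℚ≥0 (augMon k)

theorem aug_single (k : Type*) [Field k] (r : ℚ≥0) (c : k) :
    aug k (AddMonoidAlgebra.single r c) = if r = 0 then c else 0 := by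
  simp [aug, augMon, AddMonoidAlgebra.lift_single]

/-- The ideal `𝔮` of `k[T]_ℚ` generated by the monomials `T^q`, `q > 0`, is
maximal and satisfies `𝔮² = 𝔮`; in particular the Zariski cotangent space `𝔮/𝔮²` is zero. -/
theorem stmt5 (k : Type*) [Field k]
    (q : Ideal (AddMonoidAlgebra k ℚ≥0))
    (hq : q = Ideal.span ({f | ∃ r : ℚ≥0, 0 < r ∧ f = AddMonoidAlgebra.single r 1} :
      Set (AddMonoidAlgebra k ℚ≥0))) :
    q.IsMaximal ∧ q ^ 2 = q ∧ Subsingleton q.Cotangent := by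
  have hmem : ∀ r : ℚ≥0, 0 < r → ∀ c : k, AddMonoidAlgebra.single r c ∈ q := by
    intro r hr c
    have h1 : (AddMonoidAlgebra.single r 1 : AddMonoidAlgebra k ℚ≥0) ∈ q := by
      rw [hq]
      exact Ideal.subset_span ⟨r, hr, rfl⟩
    have := q.mul_mem_left (AddMonoidAlgebra.single 0 c) h1
    simpa [AddMonoidAlgebra.single_mul_single] using this
  have hsub : ∀ f : AddMonoidAlgebra k ℚ≥0,
      f - AddMonoidAlgebra.single 0 (aug k f) ∈ q := by
    intro f
    induction f using AddMonoidAlgebra.induction_linear with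
    | zero => simp
    | add f g hf hg =>
      have := q.add_mem hf hg
      rw [map_add, AddMonoidAlgebra.single_add]
      convert this using 1
      abel
    | single r c =>
      rw [aug_single]
      split_ifs with h
      · simp [h]
      · simpa using hmem r (pos_iff_ne_zero.mpr h) c
  have hker : q = RingHom.ker (aug k) := by
    apply le_antisymm
    · rw [hq, Ideal.span_le]
      rintro _ ⟨r, hr, rfl⟩
      simp [RingHom.mem_ker, aug_single, hr.ne']
    · intro f hf
      have := hsub f
      rw [RingHom.mem_ker] at hf
      simpa [hf] using this
  have hsq : q ^ 2 = q := by
    apply le_antisymm (Ideal.pow_le_self two_ne_zero)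
    conv_lhs => rw [hq]
    rw [Ideal.span_le]
    rintro _ ⟨r, hr, rfl⟩
    have h := Ideal.mul_mem_mul (hmem (r / 2) (by positivity) 1) (hmem (r / 2) (by positivity) 1)
    rw [AddMonoidAlgebra.single_mul_single, add_halves, mul_one] at h
    rw [pow_two]
    exact h
  refine ⟨?_, hsq, ?_⟩
  · rw [hker]
    apply RingHom.ker_isMaximal_of_surjective
    intro c
    exact ⟨AddMonoidAlgebra.single 0 c, by simp [aug_single]⟩
  · rw [Ideal.cotangent_subsingleton_iff, IsIdempotentElem, ← pow_two]
    exact hsq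
end

section
/- Let p be a prime, k a perfect field of characteristic p, n ≥ 1, and A := k[X_1,…,X_n]_{ℤ[1/p]}. Then the map sending a k-algebra homomorphism φ : A → k to the tuple (φ(X_1),…,φ(X_n)) ∈ k^n is a bijection between the set of k-algebra homomorphisms A → k and k^n. -/
open scoped NNRat

/-- The additive submonoid of `ℚ≥0` of rationals with `p`-power denominator. -/
def Mp (p : ℕ) : AddSubmonoid ℚ≥0 where
  carrier := {q : ℚ≥0 | ∃ m : ℕ, ∃ c : ℕ, (p : ℚ≥0) ^ m * q = (c : ℚ≥0)}
  zero_mem' := ⟨0, 0, by simp⟩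
  add_mem' := by
    rintro a b ⟨m, c, hc⟩ ⟨m', c', hc'⟩
    refine ⟨m + m', c * p ^ m' + c' * p ^ m, ?_⟩
    have h : (p : ℚ≥0) ^ (m + m') * (a + b)
        = ((p : ℚ≥0) ^ m * a) * (p : ℚ≥0) ^ m' + ((p : ℚ≥0) ^ m' * b) * (p : ℚ≥0) ^ m := by
      ring
    rw [h, hc, hc']
    push_cast
    ring

/-- `1` as an element of `Mp p`. -/
def Mp.one (p : ℕ) : Mp p := ⟨1, 0, 1, by norm_num⟩

theorem Mp.pow_inj {p : ℕ} {k : Type*} [Field k] [ExpChar k p] [PerfectRing k p] (m : ℕ) {a b : k}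
    (h : a ^ p ^ m = b ^ p ^ m) : a = b := by
  apply (bijective_iterateFrobenius k p m).1
  simpa [iterateFrobenius_def] using h

theorem Mp.exists_pow {p : ℕ} (hp : p.Prime) {k : Type*} [Field k] [ExpChar k p] [PerfectRing k p]
    (x : k) (q : Mp p) :
    ∃ y : k, ∀ m c : ℕ, (p : ℚ≥0) ^ m * (q : ℚ≥0) = (c : ℚ≥0) → y ^ p ^ m = x ^ c := by
  obtain ⟨q, m0, c0, h0⟩ := q
  obtain ⟨y, hy⟩ := (bijective_iterateFrobenius k p m0).2 (x ^ c0)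
  rw [iterateFrobenius_def] at hy
  refine ⟨y, fun m c h => Mp.pow_inj (p := p) m0 ?_⟩
  have e : c0 * p ^ m = c * p ^ m0 := by
    have : (c0 : ℚ≥0) * p ^ m = c * p ^ m0 := by
      rw [← h0, ← h]; ring
    exact_mod_cast this
  rw [← pow_mul, mul_comm, pow_mul, hy, ← pow_mul, ← pow_mul, e]

/-- The multiplicative map `q ↦ x ^ q`. -/
noncomputable def Mp.powHom {p : ℕ} (hp : p.Prime) {k : Type*} [Field k] [ExpChar k p]
    [PerfectRing k p] (x : k) : Multiplicative (Mp p) →* k where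
  toFun q := (Mp.exists_pow hp x q.toAdd).choose
  map_one' := by
    have h := (Mp.exists_pow hp x (0 : Mp p)).choose_spec 0 0 (by simp)
    simpa using h
  map_mul' a b := by
    have ha := (Mp.exists_pow hp x a.toAdd).choose_spec
    have hb := (Mp.exists_pow hp x b.toAdd).choose_spec
    have hab := (Mp.exists_pow hp x (a * b).toAdd).choose_spec
    obtain ⟨m, c, hc⟩ := a.toAdd.2
    obtain ⟨m', c', hc'⟩ := b.toAdd.2
    have h1 : (p : ℚ≥0) ^ (m + m') * (a.toAdd : ℚ≥0) = ((c * p ^ m' : ℕ) : ℚ≥0) := by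
      push_cast; rw [← hc]; ring
    have h2 : (p : ℚ≥0) ^ (m + m') * (b.toAdd : ℚ≥0) = ((c' * p ^ m : ℕ) : ℚ≥0) := by
      push_cast; rw [← hc']; ring
    have h3 : (p : ℚ≥0) ^ (m + m') * ((a * b).toAdd : ℚ≥0)
        = ((c * p ^ m' + c' * p ^ m : ℕ) : ℚ≥0) := by
      rw [toAdd_mul, AddSubmonoid.coe_add, mul_add, h1, h2]; push_cast; rfl
    apply Mp.pow_inj (p := p) (m + m')
    rw [mul_pow, ha _ _ h1, hb _ _ h2, hab _ _ h3, pow_add]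

theorem Mp.powHom_one {p : ℕ} (hp : p.Prime) {k : Type*} [Field k] [ExpChar k p]
    [PerfectRing k p] (x : k) : Mp.powHom hp x (Multiplicative.ofAdd (Mp.one p)) = x := by
  have h := (Mp.exists_pow hp x (Mp.one p)).choose_spec 0 1 (by simp [Mp.one])
  rw [pow_zero, pow_one, pow_one] at h
  exact h

theorem Mp.hom_ext {p : ℕ} {k : Type*} [Field k] [ExpChar k p]
    [PerfectRing k p] (f g : Multiplicative (Mp p) →* k)
    (h : f (Multiplicative.ofAdd (Mp.one p)) = g (Multiplicative.ofAdd (Mp.one p))) : f = g := by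
  refine MonoidHom.ext fun q => ?_
  obtain ⟨m, c, hc⟩ := q.toAdd.2
  have e : q ^ p ^ m = (Multiplicative.ofAdd (Mp.one p)) ^ c := by
    apply Multiplicative.toAdd.injective
    apply Subtype.ext
    simpa [Mp.one] using hc
  apply Mp.pow_inj (p := p) m
  rw [← map_pow, ← map_pow, e, map_pow, map_pow, h]

/-- For a prime `p`, a perfect field `k` of characteristic `p`, `n ≥ 1` and
`A := k[X_1,…,X_n]_{ℤ[1/p]}`, the map `φ ↦ (φ(X_1),…,φ(X_n))` is a bijection between the
set of `k`-algebra homomorphisms `A → k` and `k^n`. -/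
theorem stmt12 (p : ℕ) (hp : p.Prime) (k : Type*) [Field k] [ExpChar k p]
    [PerfectRing k p] (n : ℕ) (hn : 1 ≤ n) :
    Function.Bijective
      (fun φ : AddMonoidAlgebra k (Fin n →₀ Mp p) →ₐ[k] k =>
        fun i : Fin n =>
          φ (AddMonoidAlgebra.single (Finsupp.single i (Mp.one p)) 1)) := by
  constructor
  · intro φ ψ h
    have key : ∀ (i : Fin n) (q : Mp p),
        φ (AddMonoidAlgebra.single (Finsupp.single i q) 1)
          = ψ (AddMonoidAlgebra.single (Finsupp.single i q) 1) := by
      intro i q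
      let F : (AddMonoidAlgebra k (Fin n →₀ Mp p) →ₐ[k] k) → (Multiplicative (Mp p) →* k) :=
        fun χ => ((χ : _ →* k).comp (AddMonoidAlgebra.of k (Fin n →₀ Mp p))).comp
          (AddMonoidHom.toMultiplicative (Finsupp.singleAddHom i))
      have := Mp.hom_ext (F φ) (F ψ) (congrFun h i)
      exact DFunLike.congr_fun this (Multiplicative.ofAdd q)
    apply AddMonoidAlgebra.algHom_ext
    case single_zero_left => exact Subsingleton.elim _ _
    intro e
    induction e using Finsupp.induction_linear with
    | zero => 
      have : (AddMonoidAlgebra.single (0 : Fin n →₀ Mp p) (1 : k)) = 1 := rfl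
      rw [this, map_one, map_one]
    | add a b ha hb =>
      have : (AddMonoidAlgebra.single (a + b) (1 : k))
        = AddMonoidAlgebra.single a 1 * AddMonoidAlgebra.single b 1 := by
        rw [AddMonoidAlgebra.single_mul_single, one_mul]
      rw [this, map_mul, map_mul, ha, hb]
    | single i q => exact key i q
  · intro x
    let F : Multiplicative (Fin n →₀ Mp p) →* k :=
      ∏ i, (Mp.powHom hp (x i)).comp
          (AddMonoidHom.toMultiplicative (Finsupp.applyAddHom i))
    refine ⟨AddMonoidAlgebra.lift k k _ F, ?_⟩
    funext i
    have h1 : F (Multiplicative.ofAdd (Finsupp.single i (Mp.one p))) = x i := by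
      simp only [F, MonoidHom.finsetProd_apply]
      rw [Finset.prod_eq_single i]
      · simpa using Mp.powHom_one hp (x i)
      · intro j _ hj
        have : (Finsupp.single i (Mp.one p)) j = 0 := Finsupp.single_eq_of_ne hj
        simp [this]
      · simp
    simpa using h1
end

section
/- Let R be a nontrivial commutative ring, n ≥ 1, S := R[X_0,…,X_n]_ℚ, X_i the monomial of exponent single i 1, and P := X_0·X_1⋯X_n. The image of each X_i is invertible in the localization Localization.Away P, so for each i there is a canonical S-algebra homomorphism α_i : Localization.Away X_i → Localization.Away P. Then the canonical map S → Localization.Away P is injective and its range equals the intersection over i of the ranges of the α_i; that is, S = ⋂_i S_{X_i} inside S_{X_0⋯X_n}. (This is the computation S ≅ ⊕_{m∈ℚ} H^0(Proj S, 𝒪(m)).) -/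
open scoped NNRat

theorem aux_cancel {R M : Type*} [CommRing R] [AddCommMonoid M] [IsCancelAdd M] (a : M)
    (f g : AddMonoidAlgebra R M)
    (h : f * AddMonoidAlgebra.single a 1 = g * AddMonoidAlgebra.single a 1) : f = g := by
  ext m
  have := congrArg (fun z => z.coeff (m + a)) h
  simpa [AddMonoidAlgebra.coeff_mul_single_add] using this

theorem aux_dvd {R ι : Type*} [CommRing R] (i j : ι) (hij : i ≠ j)
    (k m : ℚ≥0) (f g : AddMonoidAlgebra R (ι →₀ ℚ≥0))
    (h : f * AddMonoidAlgebra.single (Finsupp.single j m) 1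
      = g * AddMonoidAlgebra.single (Finsupp.single i k) 1) :
    ∃ t, f = t * AddMonoidAlgebra.single (Finsupp.single i k) 1 := by
  have key : AddMonoidAlgebra.of' R (ι →₀ ℚ≥0) (Finsupp.single i k) ∣ f := by
    rw [AddMonoidAlgebra.of'_dvd_iff_modOf_eq_zero]
    ext a
    by_cases ha : ∃ d, a = Finsupp.single i k + d
    · rw [AddMonoidAlgebra.coeff_modOf_of_exists_add _ _ _ ha]; simp
    · rw [AddMonoidAlgebra.coeff_modOf_of_not_exists_add _ _ _ ha]
      have h2 := congrArg (fun z => z.coeff (a + Finsupp.single j m)) h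
      simp only [AddMonoidAlgebra.coeff_mul_single_add, mul_one] at h2
      rw [h2, AddMonoidAlgebra.coeff_mul_single_of_forall_add_ne]
      · simp
      · intro d hd
        apply ha
        have h3 : k ≤ a i := by
          have := DFunLike.congr_fun hd i
          simp [hij, hij.symm] at this
          rw [← this]
          exact le_add_self
        refine ⟨a - Finsupp.single i k, (add_tsub_cancel_of_le ?_).symm⟩
        rwa [Finsupp.single_le_iff]
  obtain ⟨t, ht⟩ := key
  exact ⟨t, by rw [ht, mul_comm]; rfl⟩

/-- Let `S := R[X_0,…,X_n]_ℚ` and `P := X_0 ⋯ X_n`. Each `X_i` becomes a unit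
in `Localization.Away P`, giving canonical maps `α_i : Localization.Away X_i →
Localization.Away P`; the canonical map `S → Localization.Away P` is injective and its range
is the intersection of the ranges of the `α_i`. (This is `S ≅ ⊕_{m∈ℚ} H⁰(Proj S, 𝒪(m))`.) -/
theorem stmt13 (R : Type*) [CommRing R] [Nontrivial R] (n : ℕ) (hn : 1 ≤ n)
    (X : Fin (n + 1) → AddMonoidAlgebra R (Fin (n + 1) →₀ ℚ≥0))
    (hX : ∀ i, X i = AddMonoidAlgebra.single (Finsupp.single i (1 : ℚ≥0)) 1)
    (P : AddMonoidAlgebra R (Fin (n + 1) →₀ ℚ≥0)) (hP : P = ∏ i, X i) :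
    ∃ hu : ∀ i, IsUnit (algebraMap (AddMonoidAlgebra R (Fin (n + 1) →₀ ℚ≥0))
        (Localization.Away P) (X i)),
      Function.Injective (algebraMap (AddMonoidAlgebra R (Fin (n + 1) →₀ ℚ≥0))
        (Localization.Away P)) ∧
      Set.range (algebraMap (AddMonoidAlgebra R (Fin (n + 1) →₀ ℚ≥0))
        (Localization.Away P)) =
      ⋂ i, Set.range (Localization.awayLift
        (algebraMap (AddMonoidAlgebra R (Fin (n + 1) →₀ ℚ≥0)) (Localization.Away P))
        (X i) (hu i)) := by
  have hXP : ∀ i, X i ∣ P := fun i => hP ▸ Finset.dvd_prod_of_mem X (Finset.mem_univ i)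
  have hu : ∀ i, IsUnit (algebraMap (AddMonoidAlgebra R (Fin (n + 1) →₀ ℚ≥0))
        (Localization.Away P) (X i)) := fun i =>
    isUnit_of_dvd_unit (map_dvd _ (hXP i)) (IsLocalization.Away.algebraMap_isUnit P)
  have hXr : ∀ i, X i ∈ nonZeroDivisors (AddMonoidAlgebra R (Fin (n + 1) →₀ ℚ≥0)) := by
    intro i
    rw [mem_nonZeroDivisors_iff_right]
    intro f hf
    refine aux_cancel (Finsupp.single i 1) f 0 ?_
    rw [← hX, hf, zero_mul]
  have hPr : P ∈ nonZeroDivisors (AddMonoidAlgebra R (Fin (n + 1) →₀ ℚ≥0)) := by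
    rw [hP]; exact prod_mem fun i _ => hXr i
  have hinj : Function.Injective (algebraMap (AddMonoidAlgebra R (Fin (n + 1) →₀ ℚ≥0))
        (Localization.Away P)) :=
    IsLocalization.injective _ (Submonoid.powers_le.2 hPr)
  refine ⟨hu, hinj, ?_⟩
  have hpow : ∀ i (k : ℕ), X i ^ k
      = AddMonoidAlgebra.single (Finsupp.single i (k : ℚ≥0)) 1 := by
    intro i k
    rw [hX, AddMonoidAlgebra.single_pow]
    simp
  apply Set.Subset.antisymm
  · rintro _ ⟨s, rfl⟩
    refine Set.mem_iInter.2 fun i => ⟨algebraMap _ _ s, ?_⟩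
    exact IsLocalization.Away.lift_eq _ (hu i) s
  · intro x hx
    have hx' : ∀ i, ∃ (k : ℕ) (s : AddMonoidAlgebra R (Fin (n + 1) →₀ ℚ≥0)),
        x * algebraMap _ (Localization.Away P) (X i ^ k) = algebraMap _ _ s := by
      intro i
      obtain ⟨z, rfl⟩ := Set.mem_iInter.1 hx i
      obtain ⟨k, s, hs⟩ := IsLocalization.Away.surj (X i) z
      refine ⟨k, s, ?_⟩
      have := congrArg (Localization.awayLift
        (algebraMap (AddMonoidAlgebra R (Fin (n + 1) →₀ ℚ≥0)) (Localization.Away P))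
        (X i) (hu i)) hs
      rw [map_mul, map_pow] at this
      erw [IsLocalization.Away.lift_eq, IsLocalization.Away.lift_eq] at this
      rw [map_pow]
      exact this
    have hne : (0 : Fin (n + 1)) ≠ Fin.last n := by
      intro h
      have := congrArg Fin.val h
      simp at this
      omega
    obtain ⟨k, s, hs⟩ := hx' 0
    obtain ⟨m, s', hs'⟩ := hx' (Fin.last n)
    have heq : s * X (Fin.last n) ^ m = s' * X 0 ^ k := by
      apply hinj
      rw [map_mul, map_mul, ← hs, ← hs']
      ring
    rw [hpow, hpow] at heq
    obtain ⟨t, ht⟩ := aux_dvd _ _ hne _ _ _ _ heq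
    refine ⟨t, ?_⟩
    rw [← hpow] at ht
    rw [ht, map_mul] at hs
    have hun : IsUnit (algebraMap _ (Localization.Away P) (X 0 ^ k)) := by
      rw [map_pow]; exact (hu 0).pow k
    exact (hun.mul_right_cancel hs).symm
end

section
/- Let R be a commutative ring, n ≥ 0, S := R[X_0,…,X_n]_ℚ, X_i the monomial of exponent single i 1, and P := X_0·X_1⋯X_n. Then there is an R-algebra isomorphism Localization.Away P ≅ AddMonoidAlgebra R (Fin (n+1) →₀ ℚ) under which the canonical map S → Localization.Away P corresponds to the inclusion of monoid algebras induced by ℚ≥0 ↪ ℚ (monomials are sent to monomials); in particular S_{X_0⋯X_n} is a free R-module with basis the monomials X_0^{l_0}⋯X_n^{l_n} with l_i ∈ ℚ. -/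
open scoped NNRat

namespace Stmt14Aux

open AddMonoidAlgebra

/-- The exponent inclusion. -/
noncomputable abbrev inc (n : ℕ) : (Fin (n + 1) →₀ ℚ≥0) →+ (Fin (n + 1) →₀ ℚ) :=
  Finsupp.mapRange.addMonoidHom (NNRat.coeHom.toAddMonoidHom)

/-- The exponent of the product of all the variables. -/
noncomputable def ones (n : ℕ) : Fin (n + 1) →₀ ℚ≥0 := ∑ i, Finsupp.single i 1

lemma ones_apply (n : ℕ) (i : Fin (n + 1)) : ones n i = 1 := by
  classical
  simp [ones, Finsupp.finsetSum_apply, Finsupp.single_apply]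

lemma inc_apply (n : ℕ) (a : Fin (n + 1) →₀ ℚ≥0) (i : Fin (n + 1)) :
    inc n a i = (a i : ℚ) := by
  simp [inc]

lemma inc_injective (n : ℕ) : Function.Injective (inc n) := by
  intro a b h
  ext i
  have := DFunLike.congr_fun h i
  rw [inc_apply, inc_apply] at this
  exact_mod_cast this

lemma prod_single (R : Type*) [CommRing R] {n : ℕ} (s : Finset (Fin (n + 1))) :
    ∏ i ∈ s, (single (Finsupp.single i (1 : ℚ≥0)) 1 : AddMonoidAlgebra R (Fin (n + 1) →₀ ℚ≥0))
      = single (∑ i ∈ s, Finsupp.single i (1 : ℚ≥0)) 1 := by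
  classical
  induction s using Finset.induction_on with
  | empty => simp [one_def]
  | insert a s ha ih => rw [Finset.prod_insert ha, Finset.sum_insert ha, ih, single_mul_single, one_mul]

lemma exists_shift (n : ℕ) (a : Fin (n + 1) →₀ ℚ) :
    ∃ (k : ℕ) (b : Fin (n + 1) →₀ ℚ≥0), a + k • inc n (ones n) = inc n b := by
  classical
  refine ⟨∑ i, ⌈|a i|⌉₊, Finsupp.equivFunOnFinite.symm
    fun j => (a j + ((∑ i, ⌈|a i|⌉₊ : ℕ) : ℚ)).toNNRat, ?_⟩
  ext j
  have h1 : ⌈|a j|⌉₊ ≤ ∑ i, ⌈|a i|⌉₊ :=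
    Finset.single_le_sum (f := fun i => ⌈|a i|⌉₊) (fun _ _ => Nat.zero_le _) (Finset.mem_univ j)
  have h2 : |a j| ≤ ((∑ i, ⌈|a i|⌉₊ : ℕ) : ℚ) := (Nat.le_ceil _).trans (by exact_mod_cast h1)
  have h3 : 0 ≤ a j + ((∑ i, ⌈|a i|⌉₊ : ℕ) : ℚ) := by linarith [neg_abs_le (a j)]
  rw [Finsupp.add_apply, Finsupp.smul_apply, inc_apply, inc_apply, ones_apply,
    Finsupp.equivFunOnFinite_symm_apply_apply, Rat.coe_toNNRat _ h3]
  simp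

lemma surj (R : Type*) [CommRing R] (n : ℕ) (z : AddMonoidAlgebra R (Fin (n + 1) →₀ ℚ)) :
    ∃ (k : ℕ) (f : AddMonoidAlgebra R (Fin (n + 1) →₀ ℚ≥0)),
      z * (mapDomainRingHom R (inc n) (single (ones n) 1)) ^ k = mapDomainRingHom R (inc n) f := by
  induction z using AddMonoidAlgebra.induction_linear with
  | zero => exact ⟨0, 0, by simp⟩
  | add x y hx hy =>
    obtain ⟨k, f, hf⟩ := hx
    obtain ⟨l, g, hg⟩ := hy
    refine ⟨k + l, f * single (ones n) 1 ^ l + g * single (ones n) 1 ^ k, ?_⟩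
    rw [map_add, map_mul, map_mul, ← hf, ← hg, map_pow, map_pow]
    ring
  | single a r =>
    obtain ⟨k, b, h⟩ := exists_shift n a
    refine ⟨k, single b r, ?_⟩
    simp only [mapDomainRingHom_apply, mapDomain_single, single_pow, single_mul_single, one_pow,
      mul_one]
    rw [h]

lemma isLoc (R : Type*) [CommRing R] (n : ℕ) :
    letI := (mapDomainRingHom R (inc n)).toAlgebra
    IsLocalization.Away (single (ones n) 1 : AddMonoidAlgebra R (Fin (n + 1) →₀ ℚ≥0))
      (AddMonoidAlgebra R (Fin (n + 1) →₀ ℚ)) := by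
  letI := (mapDomainRingHom R (inc n)).toAlgebra
  refine IsLocalization.Away.mk _ ?_ ?_ ?_
  · change IsUnit (mapDomainRingHom R (inc n) (single (ones n) 1))
    refine IsUnit.of_mul_eq_one (single (-(inc n (ones n))) 1) ?_
    simp only [mapDomainRingHom_apply, mapDomain_single, single_mul_single, one_def, mul_one,
      add_neg_cancel]
  · intro z
    obtain ⟨k, f, h⟩ := surj R n z
    exact ⟨k, f, h⟩
  · intro a b h
    exact ⟨0, by rw [mapDomain_injective (inc_injective n) h]⟩

end Stmt14Aux

/-- Let `S := R[X_0,…,X_n]_ℚ` and `P := X_0 ⋯ X_n`. There is an `R`-algebra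
isomorphism `Localization.Away P ≅ AddMonoidAlgebra R (Fin (n+1) →₀ ℚ)` under which the
canonical map `S → Localization.Away P` corresponds to the inclusion of monoid algebras
induced by `ℚ≥0 ↪ ℚ` (monomials go to monomials); in particular `S_{X_0⋯X_n}` is a free
`R`-module with basis the monomials with arbitrary rational exponents. -/
theorem stmt14 (R : Type*) [CommRing R] (n : ℕ)
    (X : Fin (n + 1) → AddMonoidAlgebra R (Fin (n + 1) →₀ ℚ≥0))
    (hX : ∀ i, X i = AddMonoidAlgebra.single (Finsupp.single i (1 : ℚ≥0)) 1)
    (P : AddMonoidAlgebra R (Fin (n + 1) →₀ ℚ≥0)) (hP : P = ∏ i, X i) :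
    letI : Algebra R (Localization.Away P) :=
      ((algebraMap (AddMonoidAlgebra R (Fin (n + 1) →₀ ℚ≥0)) (Localization.Away P)).comp
        (algebraMap R (AddMonoidAlgebra R (Fin (n + 1) →₀ ℚ≥0)))).toAlgebra
    ∃ e : Localization.Away P ≃ₐ[R] AddMonoidAlgebra R (Fin (n + 1) →₀ ℚ),
      (∀ f : AddMonoidAlgebra R (Fin (n + 1) →₀ ℚ≥0),
        e (algebraMap (AddMonoidAlgebra R (Fin (n + 1) →₀ ℚ≥0)) (Localization.Away P) f)
          = AddMonoidAlgebra.mapDomainRingHom R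
              (Finsupp.mapRange.addMonoidHom (NNRat.coeHom.toAddMonoidHom)) f) ∧
      ∃ b : Module.Basis (Fin (n + 1) →₀ ℚ) R (Localization.Away P),
        ∀ a : Fin (n + 1) →₀ ℚ, e (b a) = AddMonoidAlgebra.single a 1 := by
  have hP1 : P = AddMonoidAlgebra.single (Stmt14Aux.ones n) 1 := by
    rw [hP, Finset.prod_congr rfl (fun i _ => hX i), Stmt14Aux.prod_single]
    rfl
  let algS := (AddMonoidAlgebra.mapDomainRingHom R (Stmt14Aux.inc n)).toAlgebra
  have hloc : IsLocalization.Away P (AddMonoidAlgebra R (Fin (n + 1) →₀ ℚ)) := by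
    rw [hP1]
    exact Stmt14Aux.isLoc R n
  let e0 : Localization.Away P ≃ₐ[AddMonoidAlgebra R (Fin (n + 1) →₀ ℚ≥0)]
      AddMonoidAlgebra R (Fin (n + 1) →₀ ℚ) :=
    IsLocalization.algEquiv (Submonoid.powers P) _ _
  have he0 : ∀ f : AddMonoidAlgebra R (Fin (n + 1) →₀ ℚ≥0),
      e0 (algebraMap _ (Localization.Away P) f)
        = AddMonoidAlgebra.mapDomainRingHom R (Stmt14Aux.inc n) f := fun f => e0.commutes f
  have htower : IsScalarTower R (AddMonoidAlgebra R (Fin (n + 1) →₀ ℚ≥0))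
      (AddMonoidAlgebra R (Fin (n + 1) →₀ ℚ)) :=
    IsScalarTower.of_algebraMap_eq fun r => by
      change _ = AddMonoidAlgebra.mapDomainRingHom R (Stmt14Aux.inc n) (algebraMap R _ r)
      simp
  let e1 : Localization.Away P ≃ₗ[R] AddMonoidAlgebra R (Fin (n + 1) →₀ ℚ) :=
    (e0.restrictScalars R).toLinearEquiv
  let b : Module.Basis (Fin (n + 1) →₀ ℚ) R (Localization.Away P) :=
    (AddMonoidAlgebra.basis (Fin (n + 1) →₀ ℚ) R).map e1.symm
  have hb : ∀ a, e0 (b a) = AddMonoidAlgebra.single a 1 := fun a => by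
    have h : e1 (b a) = AddMonoidAlgebra.basis (Fin (n + 1) →₀ ℚ) R a := by
      rw [Module.Basis.map_apply, LinearEquiv.apply_symm_apply]
    refine Eq.trans ?_ (h.trans ?_)
    · rfl
    · simp
  clear_value b e1
  clear e1
  clear_value e0
  let algR : Algebra R (Localization.Away P) :=
    ((algebraMap (AddMonoidAlgebra R (Fin (n + 1) →₀ ℚ≥0)) (Localization.Away P)).comp
      (algebraMap R (AddMonoidAlgebra R (Fin (n + 1) →₀ ℚ≥0)))).toAlgebra
  have hc : ∀ r : R, e0.toRingEquiv (algebraMap R (Localization.Away P) r)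
      = algebraMap R (AddMonoidAlgebra R (Fin (n + 1) →₀ ℚ)) r := fun r => by
    refine (he0 (algebraMap R _ r)).trans ?_
    simp
  exact ⟨AlgEquiv.ofRingEquiv (f := e0.toRingEquiv) hc, he0, b, hb⟩
end

section
/- Let R be a nontrivial commutative ring, n ≥ 1, S := R[X_0,…,X_n]_ℚ, X_i the monomial of exponent single i 1, P := X_0⋯X_n, and identify Localization.Away P with L := AddMonoidAlgebra R (Fin (n+1) →₀ ℚ) so that monomials correspond to monomials. Then for each index i, the range of the canonical map Localization.Away (∏_{j≠i} X_j) → L is exactly the R-submodule of L spanned by the monomials X^a with a(i) ≥ 0. Consequently, the quotient of L by the sum over i of these ranges is a free R-module with basis the images of the monomials X^a with a(i) < 0 for every i; and the set of such exponents a with total degree ∑_i a(i) = −(n+1) is infinite, so the degree −(n+1) homogeneous component of this quotient is a free R-module of infinite rank. (This is the computation that H^n(Proj S, 𝒪(−n−1)) is free of infinite rank.) -/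
open scoped NNRat

namespace Stmt15

open AddMonoidAlgebra

/-- the coercion of exponents -/
noncomputable def ex (n : ℕ) : (Fin (n + 1) →₀ ℚ≥0) →+ (Fin (n + 1) →₀ ℚ) :=
  Finsupp.mapRange.addMonoidHom (NNRat.coeHom.toAddMonoidHom)

lemma ex_apply (n : ℕ) (a : Fin (n + 1) →₀ ℚ≥0) (j : Fin (n + 1)) :
    ex n a j = (a j : ℚ) := rfl

/-- exponent of the product omitting i -/
noncomputable def dex (n : ℕ) (i : Fin (n + 1)) : Fin (n + 1) →₀ ℚ :=
  ∑ j ∈ Finset.univ.erase i, Finsupp.single j (1 : ℚ)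

lemma dex_self (n : ℕ) (i : Fin (n + 1)) : dex n i i = 0 := by
  simp only [dex, Finsupp.finsetSum_apply]
  refine Finset.sum_eq_zero fun j hj => ?_
  exact Finsupp.single_eq_of_ne (Finset.ne_of_mem_erase hj).symm

lemma dex_ne (n : ℕ) (i j : Fin (n + 1)) (h : j ≠ i) : dex n i j = 1 := by
  simp only [dex, Finsupp.finsetSum_apply]
  rw [Finset.sum_eq_single j]
  · simp
  · intro k _ hk
    exact Finsupp.single_eq_of_ne hk.symm
  · intro h'
    simp [h] at h'

lemma prod_single {R : Type*} [CommRing R] {M ι : Type*} [AddCommMonoid M] (s : Finset ι)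
    (f : ι → M) : ∏ j ∈ s, (single (f j) 1 : AddMonoidAlgebra R M) = single (∑ j ∈ s, f j) 1 := by
  classical
  induction s using Finset.induction_on with
  | empty => simp [one_def]
  | insert a s ha ih => rw [Finset.prod_insert ha, Finset.sum_insert ha, ih, single_mul_single, one_mul]

lemma infinite_set (n : ℕ) (hn : 1 ≤ n) :
    {a : Fin (n + 1) →₀ ℚ | (∀ i, a i < 0) ∧ ∑ i, a i = -(n + 1)}.Infinite := by
  have hl : Fin.last n ≠ 0 := by
    intro h
    have := congrArg Fin.val h
    simp at this
    omega
  let c : ℕ → ℚ := fun t => 1 / ((t : ℚ) + 2)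
  have hc0 : ∀ t, 0 < c t := fun t => by positivity
  have hc1 : ∀ t, c t < 1 := fun t => by
    have : (0 : ℚ) ≤ t := Nat.cast_nonneg t
    simp only [c]
    rw [div_lt_one (by positivity)]
    linarith
  let g : ℕ → (Fin (n + 1) →₀ ℚ) := fun t => Finsupp.equivFunOnFinite.symm
    (fun j => -1 + (if j = 0 then c t else 0) - (if j = Fin.last n then c t else 0))
  have hg : ∀ t j, g t j = -1 + (if j = 0 then c t else 0) - (if j = Fin.last n then c t else 0) :=
    fun t j => rfl
  refine Set.infinite_of_injective_forall_mem (f := g) ?_ ?_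
  · intro s t h
    have h0 := DFunLike.congr_fun h 0
    rw [hg, hg, if_pos rfl, if_pos rfl, if_neg hl.symm, if_neg hl.symm] at h0
    have : c s = c t := by linarith
    simp only [c, one_div, inv_inj] at this
    exact_mod_cast add_right_cancel this
  · intro t
    refine ⟨fun j => ?_, ?_⟩
    · rw [hg]
      have := hc0 t
      have := hc1 t
      split_ifs <;> linarith
    · simp only [hg, Finset.sum_sub_distrib, Finset.sum_add_distrib]
      simp

lemma span_eq (R : Type*) [CommRing R] (n : ℕ) (i : Fin (n + 1)) :
    Submodule.span R
      {f : AddMonoidAlgebra R (Fin (n + 1) →₀ ℚ) |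
        ∃ a : Fin (n + 1) →₀ ℚ, 0 ≤ a i ∧ f = AddMonoidAlgebra.single a 1} =
      supported R R {a | 0 ≤ a i} := by
  rw [supported_eq_span_single]
  congr 1
  ext f
  simp [eq_comm]

lemma iSup_eq (R : Type*) [CommRing R] (n : ℕ) :
    (⨆ i : Fin (n + 1), (supported R R {a : Fin (n + 1) →₀ ℚ | 0 ≤ a i})) =
      supported R R {a | ∀ i, a i < 0}ᶜ := by
  simp only [supported_eq_span_single, ← Submodule.span_iUnion, ← Set.image_iUnion]
  congr 2
  ext a
  simp

/-- coefficient restriction -/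
noncomputable def phi (R : Type*) [CommRing R] (n : ℕ) :
    AddMonoidAlgebra R (Fin (n + 1) →₀ ℚ) →ₗ[R]
      ({a : Fin (n + 1) →₀ ℚ // ∀ i, a i < 0} →₀ R) :=
  (Finsupp.lsubtypeDomain {a : Fin (n + 1) →₀ ℚ | ∀ i, a i < 0}).comp
    (coeffLinearEquiv R).toLinearMap

lemma phi_apply (R : Type*) [CommRing R] (n : ℕ) (x) (a) :
    phi R n x a = x.coeff a.1 := rfl

lemma phi_single (R : Type*) [CommRing R] (n : ℕ)
    (a : {a : Fin (n + 1) →₀ ℚ // ∀ i, a i < 0}) (r : R) :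
    phi R n (single a.1 r) = Finsupp.single a r := by
  classical
  ext b
  rw [phi_apply, coeff_single_apply, Finsupp.single_apply]
  simp only [Subtype.ext_iff]

lemma phi_surj (R : Type*) [CommRing R] (n : ℕ) : LinearMap.range (phi R n) = ⊤ := by
  rw [eq_top_iff]
  rintro f -
  induction f using Finsupp.induction_linear with
  | zero => exact Submodule.zero_mem _
  | add f g hf hg => exact Submodule.add_mem _ hf hg
  | single a r => exact ⟨_, phi_single R n a r⟩

lemma phi_ker (R : Type*) [CommRing R] (n : ℕ) :
    supported R R {a : Fin (n + 1) →₀ ℚ | ∀ i, a i < 0}ᶜ = LinearMap.ker (phi R n) := by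
  ext x
  rw [mem_supported', LinearMap.mem_ker, Finsupp.ext_iff]
  simp only [phi_apply, Subtype.forall]
  simp

lemma range_eq {R : Type*} [CommRing R] (n : ℕ) (i : Fin (n + 1))
    (ι : AddMonoidAlgebra R (Fin (n + 1) →₀ ℚ≥0) →+* AddMonoidAlgebra R (Fin (n + 1) →₀ ℚ))
    (hι : ∀ a r, ι (single a r) = single (ex n a) r)
    (p : AddMonoidAlgebra R (Fin (n + 1) →₀ ℚ≥0))
    (hp : ι p = single (dex n i) 1) (hu : IsUnit (ι p)) :
    Set.range (Localization.awayLift ι p hu) =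
      ↑(Submodule.span R
      {f : AddMonoidAlgebra R (Fin (n + 1) →₀ ℚ) |
        ∃ a : Fin (n + 1) →₀ ℚ, 0 ≤ a i ∧ f = AddMonoidAlgebra.single a 1}) := by
  have hpk : ∀ k : ℕ, ι (p ^ k) = single (k • dex n i) 1 := fun k => by
    rw [map_pow, hp, single_pow, one_pow]
  have halg : ∀ x, Localization.awayLift ι p hu (algebraMap _ _ x) = ι x := fun x =>
    IsLocalization.Away.lift_eq p hu x
  have hkey : ∀ x (k : ℕ) z, z * algebraMap _ (Localization.Away p) (p ^ k) = algebraMap _ _ x →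
      Localization.awayLift ι p hu z = ι x * single (-(k • dex n i)) 1 := by
    intro x k z hz
    have := congrArg (Localization.awayLift ι p hu) hz
    rw [map_mul, halg, halg, hpk] at this
    rw [← this, mul_assoc, single_mul_single, add_neg_cancel, one_mul, ← one_def, mul_one]
  apply Set.Subset.antisymm
  · rintro _ ⟨z, rfl⟩
    obtain ⟨⟨x, ⟨_, k, rfl⟩⟩, hz⟩ := IsLocalization.surj (Submonoid.powers p) z
    rw [hkey x k z hz, span_eq]
    clear hz
    induction x using AddMonoidAlgebra.induction_linear with
    | zero => simp
    | add f g hf hg =>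
      rw [map_add, add_mul]
      exact Submodule.add_mem _ hf hg
    | single a r =>
      rw [hι, single_mul_single, mul_one]
      classical
      rw [SetLike.mem_coe, mem_supported']
      intro m hm
      rw [coeff_single_apply, if_neg]
      rintro rfl
      apply hm
      simp [ex_apply, dex_self]
  · intro f hf
    change f ∈ (Localization.awayLift ι p hu).range
    induction hf using Submodule.span_induction with
    | zero => exact zero_mem _
    | add f g _ _ hf hg => exact add_mem hf hg
    | smul r f _ hf =>
      have : r • f = single 0 r * f := by
        ext m
        simp [coeff_single_zero_mul]
      rw [this]
      refine mul_mem ⟨algebraMap _ _ (single (0 : Fin (n + 1) →₀ ℚ≥0) r), ?_⟩ hf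
      rw [halg, hι, map_zero]
    | mem f hf =>
      obtain ⟨a, ha, rfl⟩ := hf
      obtain ⟨k, hk⟩ : ∃ k : ℕ, ∀ j, -a j ≤ k := by
        obtain ⟨k, hk⟩ := exists_nat_ge (∑ j, |a j|)
        refine ⟨k, fun j => ?_⟩
        have : |a j| ≤ ∑ j, |a j| := Finset.single_le_sum (f := fun j => |a j|) (fun j _ => abs_nonneg _)
          (Finset.mem_univ j)
        have := neg_le_abs (a j)
        linarith
      let b : Fin (n + 1) →₀ ℚ≥0 := Finsupp.equivFunOnFinite.symm
        (fun j => (a j + k * dex n i j).toNNRat)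
      have hb : ex n b = a + k • dex n i := by
        ext j
        rw [ex_apply]
        change (((a j + k * dex n i j).toNNRat : ℚ≥0) : ℚ) = _
        rw [Rat.coe_toNNRat]
        · simp
        · by_cases h : j = i
          · subst h
            simpa [dex_self] using ha
          · rw [dex_ne n i j h]
            linarith [hk j]
      refine ⟨IsLocalization.mk' _ (single b 1) (⟨p ^ k, k, rfl⟩ : Submonoid.powers p), ?_⟩
      rw [hkey (single b 1) k _ (IsLocalization.mk'_spec _ _ _), hι, hb, single_mul_single]
      simp

end Stmt15

/-- With `S := R[X_0,…,X_n]_ℚ`, `L := AddMonoidAlgebra R (Fin (n+1) →₀ ℚ)`,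
`ι : S → L` the monomial inclusion (identifying `Localization.Away (X_0⋯X_n)` with `L`):
for each `i` the range of the canonical map `Localization.Away (∏_{j≠i} X_j) → L` is the
`R`-span of the monomials `X^a` with `a i ≥ 0`; the quotient of `L` by the sum of these is
free with basis the monomials with all exponents negative; and the set of such exponents of
total degree `-(n+1)` is infinite (so `H^n(Proj S, 𝒪(-n-1))` is free of infinite rank). -/
theorem stmt15 (R : Type*) [CommRing R] [Nontrivial R] (n : ℕ) (hn : 1 ≤ n)
    (X : Fin (n + 1) → AddMonoidAlgebra R (Fin (n + 1) →₀ ℚ≥0))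
    (hX : ∀ i, X i = AddMonoidAlgebra.single (Finsupp.single i (1 : ℚ≥0)) 1)
    (ι : AddMonoidAlgebra R (Fin (n + 1) →₀ ℚ≥0) →+* AddMonoidAlgebra R (Fin (n + 1) →₀ ℚ))
    (hι : ι = AddMonoidAlgebra.mapDomainRingHom R
      (Finsupp.mapRange.addMonoidHom (NNRat.coeHom.toAddMonoidHom)))
    (N : Fin (n + 1) → Submodule R (AddMonoidAlgebra R (Fin (n + 1) →₀ ℚ)))
    (hN : ∀ i, N i = Submodule.span R
      {f | ∃ a : Fin (n + 1) →₀ ℚ, 0 ≤ a i ∧ f = AddMonoidAlgebra.single a 1}) :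
    ∃ hu : ∀ i, IsUnit (ι (∏ j ∈ Finset.univ.erase i, X j)),
      (∀ i, Set.range
          (Localization.awayLift ι (∏ j ∈ Finset.univ.erase i, X j) (hu i)) = ↑(N i)) ∧
      (∃ b : Module.Basis {a : Fin (n + 1) →₀ ℚ // ∀ i, a i < 0} R
          (AddMonoidAlgebra R (Fin (n + 1) →₀ ℚ) ⧸ (⨆ i, N i)),
        ∀ a : {a : Fin (n + 1) →₀ ℚ // ∀ i, a i < 0},
          b a = Submodule.Quotient.mk (AddMonoidAlgebra.single a.1 1)) ∧
      {a : Fin (n + 1) →₀ ℚ | (∀ i, a i < 0) ∧ ∑ i, a i = -(n + 1)}.Infinite := by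
  have hι' : ∀ a r, ι (AddMonoidAlgebra.single a r) =
      AddMonoidAlgebra.single (Stmt15.ex n a) r := by
    intro a r
    rw [hι]
    exact AddMonoidAlgebra.mapDomain_single
  have hp : ∀ i, ι (∏ j ∈ Finset.univ.erase i, X j) =
      AddMonoidAlgebra.single (Stmt15.dex n i) 1 := by
    intro i
    rw [map_prod, Stmt15.dex, ← Stmt15.prod_single]
    refine Finset.prod_congr rfl fun j _ => ?_
    rw [hX, hι']
    congr 1
    simp [Stmt15.ex]
  have hu : ∀ i, IsUnit (ι (∏ j ∈ Finset.univ.erase i, X j)) := by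
    intro i
    rw [hp]
    refine IsUnit.of_mul_eq_one (AddMonoidAlgebra.single (-Stmt15.dex n i) 1) ?_
    rw [AddMonoidAlgebra.single_mul_single, add_neg_cancel, one_mul, AddMonoidAlgebra.one_def]
  refine ⟨hu, fun i => ?_, ?_, Stmt15.infinite_set n hn⟩
  · rw [hN]
    exact Stmt15.range_eq n i ι hι' _ (hp i) (hu i)
  · have hS : (⨆ i, N i) = LinearMap.ker (Stmt15.phi R n) := by
      rw [← Stmt15.phi_ker, ← Stmt15.iSup_eq]
      exact iSup_congr fun i => by rw [hN, Stmt15.span_eq]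
    let e := (Submodule.quotEquivOfEq _ _ hS).trans
      ((Stmt15.phi R n).quotKerEquivOfSurjective (LinearMap.range_eq_top.1 (Stmt15.phi_surj R n)))
    refine ⟨Module.Basis.ofRepr e, fun a => ?_⟩
    rw [Module.Basis.coe_ofRepr, LinearEquiv.symm_apply_eq]
    exact (Stmt15.phi_single R n a 1).symm
end

section
/- (Projective Nullstellensatz, emptiness criterion.) Let k be an uncountable algebraically closed field, n ≥ 0, and A := k[T_0,…,T_n]_ℚ. Let J be an ideal of A generated by finitely many homogeneous elements. Then the following are equivalent: (i) every k-algebra homomorphism φ : A → k with J ⊆ ker φ satisfies φ(T_i) = 0 for all i (i.e. the projective zero set V(J) ⊆ ℙ^n is empty); (ii) T_i lies in the radical of J for every i (i.e. √J ⊇ (T_0,…,T_n)). -/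
open scoped NNRat

/-- `f ∈ k[T_0,…,T_n]_ℚ` is homogeneous (of some degree `d ∈ ℚ≥0`): every exponent `a` in
the support of `f` has total degree `∑ i, a i = d`. -/
def IsHomogeneousRD {k : Type*} [Field k] {n : ℕ}
    (f : AddMonoidAlgebra k (Fin (n + 1) →₀ ℚ≥0)) : Prop :=
  ∃ d : ℚ≥0, ∀ a ∈ f.coeff.support, ∑ i, a i = d

theorem exists_point_of_not_mem_radical {k A : Type*} [Field k] [IsAlgClosed k] [Uncountable k]
    [CommRing A] [Algebra k A] (S : Set A) (hS : S.Countable) (hspan : Submodule.span k S = ⊤)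
    (J : Ideal A) (t : A) (ht : t ∉ J.radical) :
    ∃ φ : A →ₐ[k] k, J ≤ RingHom.ker φ ∧ φ t ≠ 0 := by
  let B := Localization.Away (Ideal.Quotient.mk J t)
  have hB : Nontrivial B := by
    by_contra hn
    rw [not_nontrivial_iff_subsingleton] at hn
    have h0 : (0 : A ⧸ J) ∈ Submonoid.powers (Ideal.Quotient.mk J t) :=
      (IsLocalization.subsingleton_iff (S := B)).1 hn
    obtain ⟨m, hm⟩ := h0
    exact ht ⟨m, by
      rw [← Ideal.Quotient.eq_zero_iff_mem, map_pow]; exact hm⟩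
  obtain ⟨M, hM⟩ := Ideal.exists_maximal B
  letI : Field (B ⧸ M) := Ideal.Quotient.field M
  let g : A →ₐ[k] (B ⧸ M) := (Ideal.Quotient.mkₐ k M).comp
    ((IsScalarTower.toAlgHom k (A ⧸ J) B).comp (Ideal.Quotient.mkₐ k J))
  have hgdef : ∀ a, g a = Ideal.Quotient.mk M (algebraMap (A ⧸ J) B (Ideal.Quotient.mk J a)) :=
    fun a => rfl
  have hgt : g t ≠ 0 := by
    rw [hgdef]
    exact ((IsLocalization.Away.algebraMap_isUnit (S := B) (Ideal.Quotient.mk J t)).map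
      (Ideal.Quotient.mk M)).ne_zero
  have hgJ : ∀ a ∈ J, g a = 0 := by
    intro a ha
    rw [hgdef, Ideal.Quotient.eq_zero_iff_mem.2 ha, map_zero, map_zero]
  have hsurj : ∀ y : B ⧸ M, ∃ (a : A) (m : ℕ), y = g a * ((g t)⁻¹) ^ m := by
    intro y
    obtain ⟨b, rfl⟩ := Ideal.Quotient.mk_surjective y
    obtain ⟨m, a, hma⟩ := IsLocalization.Away.surj (S := B) (Ideal.Quotient.mk J t) b
    obtain ⟨a, rfl⟩ := Ideal.Quotient.mk_surjective a
    refine ⟨a, m, ?_⟩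
    have := congrArg (Ideal.Quotient.mk M) hma
    rw [map_mul, map_pow, ← hgdef, ← hgdef] at this
    rw [← this, inv_pow, mul_assoc, mul_inv_cancel₀ (pow_ne_zero _ hgt), mul_one]
  let T : Set (B ⧸ M) := ⋃ m : ℕ, (fun a => g a * ((g t)⁻¹) ^ m) '' S
  have hTc : T.Countable := Set.countable_iUnion fun m => hS.image _
  have hT : Submodule.span k T = ⊤ := by
    rw [eq_top_iff]
    intro y _
    obtain ⟨a, m, rfl⟩ := hsurj y
    have ha : a ∈ Submodule.span k S := hspan ▸ Submodule.mem_top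
    induction ha using Submodule.span_induction with
    | mem x hx => exact Submodule.subset_span (Set.mem_iUnion.2 ⟨m, x, hx, rfl⟩)
    | zero => simp
    | add x y _ _ hx hy =>
      rw [map_add, add_mul]; exact add_mem (hx trivial) (hy trivial)
    | smul c x _ hx =>
      rw [map_smul, smul_mul_assoc]; exact Submodule.smul_mem _ _ (hx trivial)
  have hrank : Module.rank k (B ⧸ M) ≤ Cardinal.aleph0 := by
    rw [← rank_top, ← hT]
    exact (rank_span_le T).trans hTc.le_aleph0
  have halg : Algebra.IsAlgebraic k (B ⧸ M) := by
    refine ⟨fun x => ?_⟩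
    by_contra hx
    have h1 := (Transcendental.linearIndependent_sub_inv (F := k) hx).cardinal_lift_le_rank
    have h2 := h1.trans (Cardinal.lift_le.2 hrank)
    rw [Cardinal.lift_aleph0, Cardinal.lift_le_aleph0, Cardinal.mk_le_aleph0_iff] at h2
    exact not_countable (α := k) h2
  have hint : Algebra.IsIntegral k (B ⧸ M) := Algebra.isAlgebraic_iff_isIntegral.1 halg
  have hbij : Function.Bijective (algebraMap k (B ⧸ M)) :=
    IsAlgClosed.algebraMap_bijective_of_isIntegral (k := k) (K := B ⧸ M)
  let e : k ≃ₐ[k] (B ⧸ M) := AlgEquiv.ofBijective (Algebra.ofId k (B ⧸ M)) hbij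
  refine ⟨(e.symm : (B ⧸ M) →ₐ[k] k).comp g, fun a ha => ?_, ?_⟩
  · simp [RingHom.mem_ker, hgJ a ha]
  · simpa using hgt

/-- projective Nullstellensatz, emptiness criterion: over an uncountable
algebraically closed field `k`, for an ideal `J` of `A := k[T_0,…,T_n]_ℚ` generated by
finitely many homogeneous elements, the projective zero set `V(J)` is empty (every
`k`-algebra homomorphism `φ : A → k` killing `J` kills every `T_i`) iff every `T_i` lies in
the radical of `J`. -/
theorem stmt16 (k : Type*) [Field k] [IsAlgClosed k] [Uncountable k] (n : ℕ)
    (J : Ideal (AddMonoidAlgebra k (Fin (n + 1) →₀ ℚ≥0)))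
    (hJ : ∃ s : Finset (AddMonoidAlgebra k (Fin (n + 1) →₀ ℚ≥0)),
      (∀ f ∈ s, IsHomogeneousRD f) ∧ J = Ideal.span ↑s) :
    (∀ φ : AddMonoidAlgebra k (Fin (n + 1) →₀ ℚ≥0) →ₐ[k] k, J ≤ RingHom.ker φ →
        ∀ i : Fin (n + 1), φ (AddMonoidAlgebra.single (Finsupp.single i (1 : ℚ≥0)) 1) = 0)
      ↔ ∀ i : Fin (n + 1),
          (AddMonoidAlgebra.single (Finsupp.single i (1 : ℚ≥0)) 1 :
            AddMonoidAlgebra k (Fin (n + 1) →₀ ℚ≥0)) ∈ J.radical := by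
  constructor
  · intro h i
    by_contra hi
    obtain ⟨φ, hφ, hne⟩ := exists_point_of_not_mem_radical (k := k)
      (Set.range fun a : Fin (n + 1) →₀ ℚ≥0 =>
        (AddMonoidAlgebra.single a 1 : AddMonoidAlgebra k (Fin (n + 1) →₀ ℚ≥0)))
      (Set.countable_range _)
      (by
        rw [eq_top_iff]
        intro f _
        induction f using AddMonoidAlgebra.induction_linear with
        | zero => exact zero_mem _
        | add f g hf hg => exact add_mem (hf trivial) (hg trivial)
        | single a b =>
          have : (AddMonoidAlgebra.single a b : AddMonoidAlgebra k (Fin (n + 1) →₀ ℚ≥0))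
              = b • AddMonoidAlgebra.single a 1 := by simp
          rw [this]
          exact Submodule.smul_mem _ _ (Submodule.subset_span ⟨a, rfl⟩)) J _ hi
    exact hne (h φ hφ i)
  · intro h φ hφ i
    obtain ⟨m, hm⟩ := h i
    have := hφ hm
    rw [RingHom.mem_ker, map_pow] at this
    exact eq_zero_of_pow_eq_zero this
end

section
/- (Projective Nullstellensatz, ideal of the zero set.) Let k be an uncountable algebraically closed field, n ≥ 0, and A := k[T_0,…,T_n]_ℚ. Let J be an ideal of A generated by finitely many homogeneous elements, and suppose there exists a k-algebra homomorphism φ₀ : A → k with J ⊆ ker φ₀ and φ₀(T_i) ≠ 0 for some i (i.e. the projective zero set V(J) is nonempty). Then for every f ∈ A: f lies in the radical of J if and only if φ(f) = 0 for every k-algebra homomorphism φ : A → k such that J ⊆ ker φ and φ(T_i) ≠ 0 for some i. In other words, I(V(J)) = √J. -/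
open scoped NNRat

namespace RDNull

open AddMonoidAlgebra

variable {k : Type*} [Field k] {n : ℕ}

/-- Total degree. -/
noncomputable def deg (n : ℕ) : (Fin (n + 1) →₀ ℚ≥0) →+ ℚ≥0 where
  toFun a := ∑ i, a i
  map_zero' := by simp
  map_add' a b := by simp [Finset.sum_add_distrib]

theorem deg_apply (a : Fin (n + 1) →₀ ℚ≥0) : deg n a = ∑ i, a i := rfl

theorem deg_eq_zero {a : Fin (n + 1) →₀ ℚ≥0} (h : deg n a = 0) : a = 0 := by
  rw [deg_apply, Finset.sum_eq_zero_iff] at h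
  ext i
  simpa using h i (Finset.mem_univ i)

/-- The inclusion of the usual polynomial ring. -/
noncomputable def incl (k : Type*) [Field k] (n : ℕ) :
    MvPolynomial (Fin (n + 1)) k →ₐ[k] AddMonoidAlgebra k (Fin (n + 1) →₀ ℚ≥0) :=
  MvPolynomial.aeval fun i => single (Finsupp.single i (1 : ℚ≥0)) 1

theorem single_i_pow (i : Fin (n + 1)) (q : ℚ≥0) :
    (single (Finsupp.single i q) (1 : k)) ^ q.den =
      (single (Finsupp.single i (1 : ℚ≥0)) (1 : k)) ^ q.num := by
  rw [single_pow, single_pow, Finsupp.smul_single, Finsupp.smul_single,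
    one_pow, one_pow, nsmul_eq_mul, nsmul_eq_mul, mul_one, NNRat.den_mul_eq_num]

theorem single_eq_prod (a : Fin (n + 1) →₀ ℚ≥0) :
    (single a (1 : k)) = ∏ i, single (Finsupp.single i (a i)) (1 : k) := by
  classical
  have key : ∀ s : Finset (Fin (n + 1)),
      ∏ i ∈ s, single (Finsupp.single i (a i)) (1 : k)
        = single (∑ i ∈ s, Finsupp.single i (a i)) 1 := by
    intro s
    induction s using Finset.induction_on with
    | empty => simp [one_def]
    | insert i s hi ih => rw [Finset.prod_insert hi, Finset.sum_insert hi, ih]; simp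
  rw [key]
  congr 1
  exact (Finsupp.univ_sum_single a).symm

theorem single_eq_smul (a : Fin (n + 1) →₀ ℚ≥0) (c : k) :
    single a c = algebraMap k (AddMonoidAlgebra k (Fin (n + 1) →₀ ℚ≥0)) c * single a 1 := by
  rw [← Algebra.smul_def]; simp

theorem incl_integral : (incl k n).toRingHom.IsIntegral := by
  intro x
  induction x using AddMonoidAlgebra.induction_linear with
  | zero => exact RingHom.isIntegralElem_zero _
  | add x y hx hy => exact RingHom.IsIntegralElem.add _ hx hy
  | single a c =>
    letI := (incl k n).toRingHom.toAlgebra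
    have hmon : IsIntegral (MvPolynomial (Fin (n + 1)) k) (single a (1 : k)) := by
      rw [single_eq_prod]
      refine IsIntegral.prod _ fun i _ => ?_
      refine IsIntegral.of_pow (a i).den_pos ?_
      rw [single_i_pow]
      refine IsIntegral.pow ?_ _
      have : single (Finsupp.single i (1 : ℚ≥0)) (1 : k) =
          (incl k n).toRingHom (MvPolynomial.X i) := by simp [incl]
      rw [this]
      exact isIntegral_algebraMap (R := MvPolynomial (Fin (n + 1)) k)
    rw [single_eq_smul]
    refine RingHom.IsIntegralElem.mul _ ?_ hmon
    have : algebraMap k (AddMonoidAlgebra k (Fin (n + 1) →₀ ℚ≥0)) c =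
      (incl k n).toRingHom (MvPolynomial.C c) := by
        rw [← MvPolynomial.algebraMap_eq]; exact ((incl k n).commutes c).symm
    rw [this]
    exact RingHom.isIntegralElem_map _

theorem jac : IsJacobsonRing (AddMonoidAlgebra k (Fin (n + 1) →₀ ℚ≥0)) :=
  isJacobsonRing_of_isIntegral' _ (incl_integral (k := k) (n := n))

theorem exists_point [IsAlgClosed k] (M : Ideal (AddMonoidAlgebra k (Fin (n + 1) →₀ ℚ≥0)))
    (hM : M.IsMaximal) :
    ∃ φ : AddMonoidAlgebra k (Fin (n + 1) →₀ ℚ≥0) →ₐ[k] k, ∀ x, φ x = 0 ↔ x ∈ M := by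
  have hP : (M.comap (incl k n).toRingHom).IsMaximal :=
    Ideal.isMaximal_comap_of_isIntegral_of_isMaximal' _ incl_integral M
  have h1 := MvPolynomial.quotient_mk_comp_C_isIntegral_of_isJacobsonRing
    (M.comap (incl k n).toRingHom)
  have h2 : (Ideal.quotientMap M (incl k n).toRingHom le_rfl).IsIntegral :=
    RingHom.IsIntegral.quotient _ incl_integral
  have h3 := RingHom.IsIntegral.trans _ _ h1 h2
  have h4 : Algebra.IsIntegral k (AddMonoidAlgebra k (Fin (n + 1) →₀ ℚ≥0) ⧸ M) := by
    refine ⟨fun x => ?_⟩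
    have h5 : algebraMap k (AddMonoidAlgebra k (Fin (n + 1) →₀ ℚ≥0) ⧸ M) =
        (Ideal.quotientMap M (incl k n).toRingHom le_rfl).comp
          ((Ideal.Quotient.mk (M.comap (incl k n).toRingHom)).comp MvPolynomial.C) := by
      ext c
      simp only [RingHom.comp_apply, Ideal.quotientMap_mk]
      have : (incl k n).toRingHom (MvPolynomial.C c) = algebraMap k _ c := by
        rw [← MvPolynomial.algebraMap_eq]; exact ((incl k n).commutes c)
      rw [this]
      rfl
    have := h3 x
    rw [← h5] at this
    exact this
  have : IsDomain (AddMonoidAlgebra k (Fin (n + 1) →₀ ℚ≥0) ⧸ M) :=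
    Ideal.Quotient.isDomain_iff_prime M |>.2 hM.isPrime
  have h6 := IsAlgClosed.algebraMap_bijective_of_isIntegral (k := k)
    (K := AddMonoidAlgebra k (Fin (n + 1) →₀ ℚ≥0) ⧸ M)
  let e := AlgEquiv.ofBijective (Algebra.ofId k (AddMonoidAlgebra k (Fin (n + 1) →₀ ℚ≥0) ⧸ M)) h6
  refine ⟨e.symm.toAlgHom.comp (Ideal.Quotient.mkₐ k M), fun x => ?_⟩
  have : (e.symm.toAlgHom.comp (Ideal.Quotient.mkₐ k M)) x = e.symm (Ideal.Quotient.mk M x) := rfl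
  rw [this, EmbeddingLike.map_eq_zero_iff, Ideal.Quotient.eq_zero_iff_mem]

theorem proj_one (f : AddMonoidAlgebra k (Fin (n + 1) →₀ ℚ≥0)) (i : Fin (n + 1)) :
    ((DirectSum.decompose (gradeBy k (deg n))
      (f * single (Finsupp.single i (1 : ℚ≥0)) (1 : k)) 1 : gradeBy k (deg n) 1) :
      AddMonoidAlgebra k (Fin (n + 1) →₀ ℚ≥0)) =
      single (Finsupp.single i (1 : ℚ≥0)) (f.coeff 0) := by
  induction f using AddMonoidAlgebra.induction_linear with
  | zero => simp
  | add x y hx hy =>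
    rw [add_mul, DirectSum.decompose_add, DirectSum.add_apply, Submodule.coe_add, hx, hy]
    simp
  | single a c =>
    rw [single_mul_single, mul_one]
    by_cases ha : a = 0
    · subst ha
      rw [DirectSum.decompose_of_mem_same]
      · simp
      · have := single_mem_gradeBy (R := k) (deg n) (0 + Finsupp.single i (1 : ℚ≥0)) c
        have h1 : deg n (0 + Finsupp.single i (1 : ℚ≥0)) = 1 := by
          simp [deg_apply, Finsupp.single_apply]
        rwa [h1] at this
    · rw [DirectSum.decompose_of_mem_ne (ℳ := gradeBy k (deg n))
        (single_mem_gradeBy (R := k) (deg n) (a + Finsupp.single i (1 : ℚ≥0)) c)]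
      · simp [coeff_single, Finsupp.single_apply, ha]
      · have h1 : deg n (Finsupp.single i (1 : ℚ≥0)) = 1 := by
          simp [deg_apply, Finsupp.single_apply]
        rw [map_add, h1]
        intro h
        exact ha (deg_eq_zero (by simpa using h))

theorem mem_of_coeff_zero (M : Ideal (AddMonoidAlgebra k (Fin (n + 1) →₀ ℚ≥0)))
    (hM : M.IsPrime) (hT : ∀ i, single (Finsupp.single i (1 : ℚ≥0)) (1 : k) ∈ M)
    (f : AddMonoidAlgebra k (Fin (n + 1) →₀ ℚ≥0)) (hf : f.coeff 0 = 0) : f ∈ M := by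
  rw [← f.sum_coeff_single]
  refine Ideal.sum_mem _ fun a ha => ?_
  have ha0 : a ≠ 0 := by
    rintro rfl
    exact (Finsupp.mem_support_iff.1 ha) hf
  obtain ⟨i, hi⟩ : ∃ i, a i ≠ 0 := by
    by_contra! h
    exact ha0 (Finsupp.ext h)
  rw [single_eq_smul, single_eq_prod]
  refine Ideal.mul_mem_left _ _ ?_
  refine Ideal.mem_of_dvd _ (Finset.dvd_prod_of_mem _ (Finset.mem_univ i)) ?_
  refine hM.mem_of_pow_mem (a i).den ?_
  rw [single_i_pow]
  exact Ideal.pow_mem_of_mem _ (hT i) _ (Nat.pos_of_ne_zero (by simpa using hi))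

end RDNull

/-- projective Nullstellensatz, ideal of the zero set: over an uncountable
algebraically closed field `k`, for an ideal `J` of `A := k[T_0,…,T_n]_ℚ` generated by
finitely many homogeneous elements whose projective zero set is nonempty, an element
`f ∈ A` lies in `√J` iff `φ(f) = 0` for every `k`-algebra homomorphism `φ : A → k` with
`J ⊆ ker φ` representing a projective point (`φ(T_i) ≠ 0` for some `i`). -/
theorem stmt17 (k : Type*) [Field k] [IsAlgClosed k] [Uncountable k] (n : ℕ)
    (J : Ideal (AddMonoidAlgebra k (Fin (n + 1) →₀ ℚ≥0)))
    (hJ : ∃ s : Finset (AddMonoidAlgebra k (Fin (n + 1) →₀ ℚ≥0)),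
      (∀ f ∈ s, IsHomogeneousRD f) ∧ J = Ideal.span ↑s)
    (hne : ∃ φ₀ : AddMonoidAlgebra k (Fin (n + 1) →₀ ℚ≥0) →ₐ[k] k,
      J ≤ RingHom.ker φ₀ ∧
      ∃ i : Fin (n + 1), φ₀ (AddMonoidAlgebra.single (Finsupp.single i (1 : ℚ≥0)) 1) ≠ 0)
    (f : AddMonoidAlgebra k (Fin (n + 1) →₀ ℚ≥0)) :
    f ∈ J.radical ↔
      ∀ φ : AddMonoidAlgebra k (Fin (n + 1) →₀ ℚ≥0) →ₐ[k] k, J ≤ RingHom.ker φ →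
        (∃ i : Fin (n + 1), φ (AddMonoidAlgebra.single (Finsupp.single i (1 : ℚ≥0)) 1) ≠ 0) →
        φ f = 0 := by
  constructor
  · rintro ⟨m, hm⟩ φ hφ -
    have : φ (f ^ m) = 0 := hφ hm
    rw [map_pow] at this
    exact eq_zero_of_pow_eq_zero this
  · intro h
    have hjac := RDNull.jac (k := k) (n := n)
    have hmul : ∀ i, f * AddMonoidAlgebra.single (Finsupp.single i (1 : ℚ≥0)) (1 : k)
        ∈ J.radical := by
      intro i
      rw [Ideal.radical_eq_jacobson, Ideal.jacobson, Ideal.mem_sInf]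
      rintro M ⟨hJM, hM⟩
      obtain ⟨φ, hφ⟩ := RDNull.exists_point M hM
      rw [← hφ, map_mul]
      by_cases hi : φ (AddMonoidAlgebra.single (Finsupp.single i (1 : ℚ≥0)) 1) = 0
      · rw [hi, mul_zero]
      · rw [h φ (fun x hx => (hφ x).2 (hJM hx)) ⟨i, hi⟩, zero_mul]
    have hhom : J.IsHomogeneous (AddMonoidAlgebra.gradeBy k (RDNull.deg n)) := by
      obtain ⟨s, hs, rfl⟩ := hJ
      refine Ideal.homogeneous_span _ _ fun x hx => ?_
      obtain ⟨d, hd⟩ := hs x hx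
      exact ⟨d, hd⟩
    have h0 : f.coeff 0 = 0 := by
      by_contra hc
      obtain ⟨φ₀, hφ₀, i, hi⟩ := hne
      have h1 := hhom.radical 1 (hmul i)
      rw [RDNull.proj_one] at h1
      obtain ⟨m, hm⟩ := h1
      have h2 : φ₀ (AddMonoidAlgebra.single (Finsupp.single i (1 : ℚ≥0)) (f.coeff 0) ^ m) = 0 :=
        hφ₀ hm
      rw [map_pow, RDNull.single_eq_smul, map_mul, AlgHom.commutes] at h2
      exact mul_ne_zero hc hi (eq_zero_of_pow_eq_zero h2)
    rw [Ideal.radical_eq_jacobson, Ideal.jacobson, Ideal.mem_sInf]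
    rintro M ⟨hJM, hM⟩
    by_cases hT : ∀ i, AddMonoidAlgebra.single (Finsupp.single i (1 : ℚ≥0)) (1 : k) ∈ M
    · exact RDNull.mem_of_coeff_zero M hM.isPrime hT f h0
    · push Not at hT
      obtain ⟨i, hi⟩ := hT
      obtain ⟨φ, hφ⟩ := RDNull.exists_point M hM
      rw [← hφ]
      exact h φ (fun x hx => (hφ x).2 (hJM hx)) ⟨i, fun h' => hi ((hφ _).1 h')⟩
end
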